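/- Let P be a convex polygon of n sides with sides s_0, …, s_{n−1}, and let i < j < k be three indices. Suppose there exists a closed disk Q contained in P that touches each of the sides s_i, s_j, s_k (Q ∩ s_i ≠ ∅, Q ∩ s_j ≠ ∅, Q ∩ s_k ≠ ∅), that the lines supporting s_i and s_j intersect at a point A, that the lines supporting s_j and s_k intersect at a point B, and that the side s_j is contained in the segment AB. Then the side-disk families D[i+1, j−1] and D[j+1, k−1] are independent: for every a with i < a < j and every b with j < b < k, the side disks D_a and D_b are disjoint. -/

import Mathlib

noncomputable section

/-- The Euclidean plane. -/
abbrev E2 := EuclideanSpace ℝ (Fin 2)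

/-- The side disk with diameter the segment `pq`: the closed ball centered at the
midpoint of `p` and `q` with radius `dist p q / 2`. -/
def sideDisk (p q : E2) : Set E2 := Metric.closedBall (midpoint ℝ p q) (dist p q / 2)

/-- The triple `(a, b, c)` is positively oriented (counter-clockwise):
the determinant of `(b - a, c - a)` is positive. -/
def Ccw (a b c : E2) : Prop :=
  0 < (b 0 - a 0) * (c 1 - a 1) - (b 1 - a 1) * (c 0 - a 0)

/-- `p : Fin n → E2` lists the vertices of a convex polygon in counter-clockwise
cyclic order: every triple `p i, p j, p k` with `i < j < k` is positively oriented. -/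
def IsConvexPolygon {n : ℕ} (p : Fin n → E2) : Prop :=
  ∀ i j k : Fin n, i < j → j < k → Ccw (p i) (p j) (p k)

/-- Cyclic successor in `Fin n` (i.e. `i + 1 (mod n)`). -/
def nxt {n : ℕ} (i : Fin n) : Fin n := ⟨((i : ℕ) + 1) % n, Nat.mod_lt _ i.pos⟩

/-- The `i`-th side disk of the polygon `p`: the disk with diameter the `i`-th side,
the segment from `p i` to `p (i+1)` (indices mod `n`). -/
def polyDisk {n : ℕ} (p : Fin n → E2) (i : Fin n) : Set E2 := sideDisk (p i) (p (nxt i))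

/-- The interior of the `i`-th side disk of the polygon `p` (the corresponding open ball). -/
def polyBall {n : ℕ} (p : Fin n → E2) (i : Fin n) : Set E2 :=
  Metric.ball (midpoint ℝ (p i) (p (nxt i))) (dist (p i) (p (nxt i)) / 2)

/-- The side-disk intersection graph `G(P)`: the simple graph on `Fin n` where distinct
`i, j` are adjacent iff the side disks `D_i` and `D_j` have a common point. -/
def sideDiskGraph {n : ℕ} (p : Fin n → E2) : SimpleGraph (Fin n) :=
  SimpleGraph.fromRel fun i j => (polyDisk p i ∩ polyDisk p j).Nonempty

/-- Twice the signed area of the triangle `abc`; positive iff `Ccw a b c`. -/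
def orient (a b c : E2) : ℝ :=
  (b 0 - a 0) * (c 1 - a 1) - (b 1 - a 1) * (c 0 - a 0)

/-- The dot product of `a - c` and `b - c`. -/
def dot (c a b : E2) : ℝ := (a 0 - c 0) * (b 0 - c 0) + (a 1 - c 1) * (b 1 - c 1)

/-- The cross product of `a - c` and `b - c`. -/
def cross (c a b : E2) : ℝ := (a 0 - c 0) * (b 1 - c 1) - (a 1 - c 1) * (b 0 - c 0)

lemma orient_cyclic (a b c : E2) : orient a b c = orient b c a := by
  unfold orient; ring

lemma exists_of_mem_segment {u v T : E2} (h : T ∈ segment ℝ u v) :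
    ∃ s t : ℝ, 0 ≤ s ∧ 0 ≤ t ∧ s + t = 1 ∧ ∀ l, T l = s * u l + t * v l := by
  obtain ⟨s, t, hs, ht, hst, rfl⟩ := h
  exact ⟨s, t, hs, ht, hst, fun l => by simp⟩

lemma exists_of_mem_line {u v A : E2} (h : A ∈ affineSpan ℝ ({u, v} : Set E2)) :
    ∃ s : ℝ, ∀ l, A l = u l + s * (v l - u l) := by
  obtain ⟨s, rfl⟩ := mem_affineSpan_pair_iff_exists_lineMap_eq.1 h
  exact ⟨s, fun l => by simp [AffineMap.lineMap_apply]; ring⟩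

lemma orient_combo {a b u v T : E2} {s t : ℝ} (hst : s + t = 1)
    (hT : ∀ l, T l = s * u l + t * v l) :
    orient a b T = s * orient a b u + t * orient a b v := by
  obtain rfl : s = 1 - t := by linarith
  simp only [orient, hT]; ring

lemma orient_eq_zero_of_mem_segment {u v T : E2} (hT : T ∈ segment ℝ u v) :
    orient u v T = 0 := by
  obtain ⟨s, t, -, -, hst, h⟩ := exists_of_mem_segment hT
  rw [orient_combo hst h]
  unfold orient; ring

lemma orient_eq_zero_of_mem_line {u v A : E2} (h : A ∈ affineSpan ℝ ({u, v} : Set E2)) :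
    orient u v A = 0 := by
  obtain ⟨s, h⟩ := exists_of_mem_line h
  simp only [orient, h]; ring

lemma orient_nonneg_of_mem_segment {a b u v T : E2} (hT : T ∈ segment ℝ u v)
    (hu : 0 ≤ orient a b u) (hv : 0 ≤ orient a b v) : 0 ≤ orient a b T := by
  obtain ⟨s, t, hs, ht, hst, h⟩ := exists_of_mem_segment hT
  rw [orient_combo hst h]; positivity

lemma orient_pos_of_mem_segment {a b u v T : E2} (hT : T ∈ segment ℝ u v)
    (hu : 0 < orient a b u) (hv : 0 < orient a b v) : 0 < orient a b T := by
  obtain ⟨s, t, hs, ht, hst, h⟩ := exists_of_mem_segment hT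
  rw [orient_combo hst h]
  rcases hs.eq_or_lt with rfl | hs
  · obtain rfl : t = 1 := by linarith
    linarith
  · positivity

lemma dist_sq_eq (u v : E2) : dist u v ^ 2 = (u 0 - v 0) ^ 2 + (u 1 - v 1) ^ 2 := by
  rw [EuclideanSpace.dist_eq, Real.sq_sqrt (by positivity)]
  simp [Fin.sum_univ_two, Real.dist_eq, sq_abs]

lemma nxt_val_of_lt {n : ℕ} {i : Fin n} (h : (i : ℕ) + 1 < n) : (nxt i : ℕ) = i + 1 :=
  Nat.mod_eq_of_lt h

lemma nxt_val_of_lt_fin {n : ℕ} {i j : Fin n} (h : i < j) : (nxt i : ℕ) = i + 1 :=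
  nxt_val_of_lt (by have := j.isLt; have : (i : ℕ) < j := h; omega)

lemma nxt_val_cases {n : ℕ} (i : Fin n) :
    (nxt i : ℕ) = i + 1 ∨ ((nxt i : ℕ) = 0 ∧ (i : ℕ) + 1 = n) := by
  rcases lt_or_eq_of_le (Nat.succ_le_of_lt i.isLt) with h | h
  · exact Or.inl (nxt_val_of_lt h)
  · refine Or.inr ⟨?_, h⟩
    change ((i : ℕ) + 1) % n = 0
    rw [show (i : ℕ) + 1 = n from h, Nat.mod_self]

section Polygon

variable {n : ℕ} {p : Fin n → E2}

lemma IsConvexPolygon.orient_nonneg (hp : IsConvexPolygon p) {a b c : Fin n}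
    (hab : a ≤ b) (hbc : b ≤ c) : 0 ≤ orient (p a) (p b) (p c) := by
  rcases hab.eq_or_lt with rfl | hab
  · simp [orient]
  rcases hbc.eq_or_lt with rfl | hbc
  · exact le_of_eq (by unfold orient; ring)
  exact (hp a b c hab hbc).le

lemma IsConvexPolygon.orient_nxt_nonneg (hp : IsConvexPolygon p) {a b k : Fin n}
    (hab : a ≤ b) (hbk : b ≤ k) : 0 ≤ orient (p a) (p b) (p (nxt k)) := by
  rcases nxt_val_cases k with h | ⟨h, -⟩
  · exact hp.orient_nonneg hab (Fin.le_def.2 (by have := Fin.le_def.1 hbk; omega))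
  · rw [← orient_cyclic]
    exact hp.orient_nonneg (Fin.le_def.2 (by omega)) hab

lemma IsConvexPolygon.orient_side_pos (hp : IsConvexPolygon p) {m l : Fin n}
    (h₁ : l ≠ m) (h₂ : l ≠ nxt m) : 0 < orient (p m) (p (nxt m)) (p l) := by
  have h₁' : (l : ℕ) ≠ m := fun h => h₁ (Fin.ext h)
  have h₂' : (l : ℕ) ≠ nxt m := fun h => h₂ (Fin.ext h)
  have hl := l.isLt
  rcases nxt_val_cases m with h | ⟨h, hm⟩
  · rcases lt_or_gt_of_ne h₁' with hlm | hlm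
    · rw [← orient_cyclic]
      exact hp l m (nxt m) hlm (Fin.lt_def.2 (by omega))
    · exact hp m (nxt m) l (Fin.lt_def.2 (by omega)) (Fin.lt_def.2 (by omega))
  · rw [orient_cyclic]
    exact hp (nxt m) l m (Fin.lt_def.2 (by omega)) (Fin.lt_def.2 (by omega))

lemma IsConvexPolygon.orient_side_nonneg (hp : IsConvexPolygon p) (m l : Fin n) :
    0 ≤ orient (p m) (p (nxt m)) (p l) := by
  by_cases h₁ : l = m
  · subst h₁; exact le_of_eq (by unfold orient; ring)
  by_cases h₂ : l = nxt m
  · subst h₂; exact le_of_eq (by unfold orient; ring)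
  exact (hp.orient_side_pos h₁ h₂).le

lemma IsConvexPolygon.orient_side_nonneg_of_mem_convexHull (hp : IsConvexPolygon p)
    (m : Fin n) {z : E2} (hz : z ∈ convexHull ℝ (Set.range p)) :
    0 ≤ orient (p m) (p (nxt m)) z := by
  refine (convexHull_min (t := {z | 0 ≤ orient (p m) (p (nxt m)) z}) ?_ ?_) hz
  · rintro _ ⟨l, rfl⟩
    exact hp.orient_side_nonneg m l
  · rw [convex_iff_segment_subset]
    intro u hu v hv T hT
    exact orient_nonneg_of_mem_segment hT hu hv

end Polygon

lemma mul_dist_le_orient {u v c : E2} {r : ℝ} (hr : 0 ≤ r)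
    (h : ∀ z ∈ Metric.closedBall c r, 0 ≤ orient u v z) :
    r * dist u v ≤ orient u v c := by
  have hd := dist_sq_eq u v
  rcases (dist_nonneg (x := u) (y := v)).eq_or_lt with h0 | hpos
  · rw [← h0, mul_zero]
    exact h c (Metric.mem_closedBall_self hr)
  set d := dist u v
  let z : E2 := !₂[c 0 + r / d * (v 1 - u 1), c 1 - r / d * (v 0 - u 0)]
  have hz : z ∈ Metric.closedBall c r := by
    rw [Metric.mem_closedBall]
    refine abs_le_of_sq_le_sq' ?_ hr |>.2
    rw [dist_sq_eq]
    apply le_of_eq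
    have : (r / d) ^ 2 * d ^ 2 = r ^ 2 := by field_simp
    simp only [z, Matrix.cons_val_zero, Matrix.cons_val_one]
    simp
    rw [← this, hd]; ring
  have := h z hz
  have key : orient u v z = orient u v c - r / d * d ^ 2 := by
    rw [hd]; simp [orient, z]; ring
  rw [key] at this
  have e : r / d * d ^ 2 = r * d := by field_simp
  linarith

/-- If a disk of radius `r` around `c`, on the left of the line `uv`, meets that line at `T`,
then it is tangent to it there, and signed distances to `uv` can be read off from `T - c`. -/
lemma tangent_identity {u v c T : E2} {r : ℝ} (hr : 0 ≤ r)
    (hle : r * dist u v ≤ orient u v c) (hT : T ∈ Metric.closedBall c r)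
    (hTl : orient u v T = 0) (z : E2) :
    dist u v * (r ^ 2 - dot c T z) = r * orient u v z := by
  have hTc : dist T c ^ 2 ≤ r ^ 2 := pow_le_pow_left₀ dist_nonneg hT 2
  rw [dist_sq_eq] at hTc
  have hd := dist_sq_eq u v
  have hd0 : 0 ≤ dist u v := dist_nonneg
  set d := dist u v
  have hO : orient u v c = (T 0 - c 0) * (v 1 - u 1) - (T 1 - c 1) * (v 0 - u 0) := by
    have : orient u v c - orient u v T =
      (T 0 - c 0) * (v 1 - u 1) - (T 1 - c 1) * (v 0 - u 0) := by unfold orient; ring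
    linarith
  -- the squared distance between `d • (T - c)` and `r` times the outer normal is nonpositive
  have hsq : (d * (T 0 - c 0) - r * (v 1 - u 1)) ^ 2 +
      (d * (T 1 - c 1) + r * (v 0 - u 0)) ^ 2 ≤ 0 := by
    have e : (d * (T 0 - c 0) - r * (v 1 - u 1)) ^ 2 + (d * (T 1 - c 1) + r * (v 0 - u 0)) ^ 2
        = d ^ 2 * ((T 0 - c 0) ^ 2 + (T 1 - c 1) ^ 2) +
          r ^ 2 * ((u 0 - v 0) ^ 2 + (u 1 - v 1) ^ 2) - 2 * (d * r) * orient u v c := by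
      rw [hO]; ring
    rw [e, ← hd]
    nlinarith [mul_le_mul_of_nonneg_left hTc (sq_nonneg d),
      mul_le_mul_of_nonneg_left hle (mul_nonneg hd0 hr)]
  have h0 : d * (T 0 - c 0) = r * (v 1 - u 1) :=
    sub_eq_zero.1 (pow_eq_zero_iff two_ne_zero |>.1 (le_antisymm
      (by linarith [sq_nonneg (d * (T 1 - c 1) + r * (v 0 - u 0))]) (sq_nonneg _)))
  have h1 : d * (T 1 - c 1) + r * (v 0 - u 0) = 0 :=
    pow_eq_zero_iff two_ne_zero |>.1 (le_antisymm
      (by linarith [sq_nonneg (d * (T 0 - c 0) - r * (v 1 - u 1))]) (sq_nonneg _))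
  have hOc : r * orient u v c = d * r ^ 2 := by
    rcases hd0.eq_or_lt with h | h
    · obtain rfl : u = v := dist_eq_zero.1 h.symm
      rw [← h]; simp [orient]
    · apply mul_left_cancel₀ h.ne'
      rw [hO]
      linear_combination r * (v 1 - u 1) * h0 - r * (v 0 - u 0) * h1 - r ^ 2 * hd
  have e : orient u v z = orient u v c -
      ((v 1 - u 1) * (z 0 - c 0) - (v 0 - u 0) * (z 1 - c 1)) := by unfold orient; ring
  rw [e, dot]
  linear_combination -(z 0 - c 0) * h0 - (z 1 - c 1) * h1 - hOc

/-- Points cut off from the unit disk by the tangency chord of its tangents at `(0, -1)` and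
`(tx, ty)`, when these meet to the left of the disk's center. -/
lemma ear_bounds {tx ty a x y : ℝ} (ht : tx ^ 2 + ty ^ 2 = 1) (hty : -1 < ty) (ha : a < 0)
    (hA : a * tx - ty = 1) (hy : -1 ≤ y) (hz : tx * x + ty * y ≤ 1)
    (ho : 0 ≤ tx * (y + 1) - (ty + 1) * x) : x ≤ 0 ∧ y < 1 ∧ (-1 < y → x < 0) := by
  have htx : tx < 0 := by nlinarith
  have hty' : 0 < ty + 1 := by linarith
  refine ⟨?_, ?_, fun hy' => ?_⟩
  · by_contra! h
    nlinarith [mul_pos hty' h]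
  · have hlt : ty < 1 := by nlinarith [mul_pos_of_neg_of_neg htx htx]
    have h1 : tx * (tx * (y + 1)) ≤ tx * ((ty + 1) * x) :=
      mul_le_mul_of_nonpos_left (by linarith) htx.le
    have h2 : (ty + 1) * (y - ty) ≤ 0 := by nlinarith
    nlinarith
  · by_contra! h
    nlinarith [mul_nonneg hty'.le h, mul_pos_of_neg_of_neg htx (by linarith : -(y + 1) < 0)]

/-- A segment from `(-P, s)` to `(-q, t)` in the strip `[-1, 1)`, at distance at least one from
the origin, is shorter than `P + q`. -/
lemma length_lt_add {P q s t d : ℝ} (hP : 0 < P) (hq : 0 ≤ q) (hs : -1 < s) (hs' : s < 1)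
    (ht : -1 ≤ t) (hd : d ^ 2 = (P - q) ^ 2 + (s - t) ^ 2) (hdc : d ≤ s * q - P * t) :
    d < P + q := by
  rcases hq.eq_or_lt with rfl | hq
  · rcases ht.eq_or_lt with rfl | ht
    · by_contra! h
      nlinarith [sq_nonneg (s + 1), mul_pos (by linarith : 0 < s + 1) (by linarith : 0 < s + 1)]
    · nlinarith
  · nlinarith

/-- If a linear form vanishing at `c`, with gradient of norm `r`, is sufficiently negative at
`u` and `v`, then it is negative on the disk with diameter `uv`. -/
lemma form_neg_of_mem_sideDisk {u v c z : E2} {g₀ g₁ r : ℝ} (hr : 0 < r)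
    (hg : g₀ ^ 2 + g₁ ^ 2 = r ^ 2)
    (hlen : r * dist u v < -(g₀ * (u 0 - c 0) + g₁ * (u 1 - c 1)) -
      (g₀ * (v 0 - c 0) + g₁ * (v 1 - c 1)))
    (hz : z ∈ sideDisk u v) : g₀ * (z 0 - c 0) + g₁ * (z 1 - c 1) < 0 := by
  have hz' : dist z (midpoint ℝ u v) ≤ dist u v / 2 := hz
  have hm : ∀ l, midpoint ℝ u v l = (u l + v l) / 2 := fun l => by
    simp [midpoint_eq_smul_add]; ring
  set m := midpoint ℝ u v
  have hcs : g₀ * (z 0 - m 0) + g₁ * (z 1 - m 1) ≤ r * dist z m := by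
    refine (abs_le_of_sq_le_sq' ?_ (mul_nonneg hr.le dist_nonneg)).2
    rw [mul_pow, dist_sq_eq, ← hg]
    nlinarith [sq_nonneg (g₀ * (z 1 - m 1) - g₁ * (z 0 - m 0))]
  have := mul_le_mul_of_nonneg_left hz' hr.le
  rw [hm, hm] at hcs
  linarith

/-- If the tangents at `W` and `T` to the circle of radius `r` around `c` meet at `A`, then a disk
whose diameter `uv` is cut off between `A` and the chord `WT`, on a line missing the open disk,
lies strictly on the same side of the line `cW` as `A`. The sign `σ` is the orientation. -/
lemma cross_neg_of_mem_sideDisk {c W T A u v z : E2} {r σ : ℝ} (hr : 0 < r) (hσ : σ ^ 2 = 1)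
    (hW : dot c W W = r ^ 2) (hT : dot c T T = r ^ 2) (hWT : dot c W T < r ^ 2)
    (hWA : dot c W A = r ^ 2) (hTA : dot c T A = r ^ 2) (hA : σ * cross c W A < 0)
    (hWu : dot c W u < r ^ 2) (hTu : dot c T u ≤ r ^ 2) (hu : 0 ≤ σ * orient W T u)
    (hWv : dot c W v ≤ r ^ 2) (hTv : dot c T v ≤ r ^ 2) (hv : 0 ≤ σ * orient W T v)
    (huv : r * dist u v ≤ σ * orient u v c) (hz : z ∈ sideDisk u v) :
    σ * cross c W z < 0 := by
  obtain ⟨k, hk⟩ : ∃ k, k = (r ^ 2)⁻¹ := ⟨_, rfl⟩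
  have hkpos : 0 < k := by rw [hk]; positivity
  have hkr : k * r ^ 2 = 1 := by rw [hk]; field_simp
  have hkW : k * dot c W W = 1 := by rw [hW, hkr]
  let X : E2 → ℝ := fun z => k * (σ * cross c W z)
  let Y : E2 → ℝ := fun z => -(k * dot c W z)
  have hXY : ∀ a b, X a * X b + Y a * Y b = k * dot c a b := fun a b => by
    simp only [X, Y]
    have e : cross c W a * cross c W b + dot c W a * dot c W b = dot c W W * dot c a b := by
      unfold cross dot; ring
    linear_combination k ^ 2 * cross c W a * cross c W b * hσ + k ^ 2 * e +
      k * dot c a b * hkW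
  have hY : ∀ a, dot c W a ≤ r ^ 2 → -1 ≤ Y a := fun a ha => by
    have := mul_le_mul_of_nonneg_left ha hkpos.le
    simp only [Y]; linarith
  have hY' : ∀ a, dot c W a < r ^ 2 → -1 < Y a := fun a ha => by
    have := mul_lt_mul_of_pos_left ha hkpos
    simp only [Y]; linarith
  have hTz : ∀ a, dot c T a ≤ r ^ 2 → X T * X a + Y T * Y a ≤ 1 := fun a ha => by
    have := mul_le_mul_of_nonneg_left ha hkpos.le
    rw [hXY]; linarith
  have hO : ∀ a, X T * (Y a + 1) - (Y T + 1) * X a = k * (σ * orient W T a) := fun a => by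
    simp only [X, Y]
    have e : dot c W T * cross c W a - cross c W T * dot c W a =
        dot c W W * (orient W T a - cross c W T + cross c W a) := by
      unfold cross dot orient; ring
    linear_combination k ^ 2 * σ * e +
      k * σ * (orient W T a - cross c W T + cross c W a) * hkW
  have hTT : X T ^ 2 + Y T ^ 2 = 1 := by
    have := hXY T T
    rw [hT, hkr] at this; linarith
  have hXA : X A < 0 := mul_neg_of_pos_of_neg hkpos hA
  have hTA' : X A * X T - Y T = 1 := by
    have h1 := hXY T A
    have h2 : Y A = -1 := by simp only [Y]; rw [hWA, hkr]
    rw [hTA, hkr, h2] at h1; linarith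
  have ear := fun a h₁ h₂ (h₃ : 0 ≤ σ * orient W T a) =>
    ear_bounds (x := X a) (y := Y a) hTT (hY' T hWT) hXA hTA' (hY a h₁) (hTz a h₂)
      (by rw [hO]; positivity)
  obtain ⟨-, hu₂, hu₃⟩ := ear u hWu.le hTu hu
  obtain ⟨hv₁, -, -⟩ := ear v hWv hTv hv
  have hlen : k * (r * dist u v) < -X u + -X v := by
    refine length_lt_add (s := Y u) (t := Y v) (neg_pos.2 (hu₃ (hY' u hWu))) (neg_nonneg.2 hv₁)
      (hY' u hWu) hu₂ (hY v hWv) ?_ ?_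
    · have e : (-X u - -X v) ^ 2 + (Y u - Y v) ^ 2 =
          k * (dot c u u + dot c v v - 2 * dot c u v) := by
        linear_combination hXY u u + hXY v v - 2 * hXY u v
      rw [e, mul_pow, mul_pow, dist_sq_eq]
      unfold dot
      linear_combination k * ((u 0 - v 0) ^ 2 + (u 1 - v 1) ^ 2) * hkr
    · have e : Y u * -X v - -X u * Y v = k * (σ * orient u v c) := by
        simp only [X, Y]
        have e : dot c W u * cross c W v - cross c W u * dot c W v =
            dot c W W * orient u v c := by
          unfold cross dot orient; ring
        linear_combination k ^ 2 * σ * e + k * σ * orient u v c * hkW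
      rw [e]
      exact mul_le_mul_of_nonneg_left huv hkpos.le
  have hform := form_neg_of_mem_sideDisk (c := c) (g₀ := -(σ * (W 1 - c 1)))
    (g₁ := σ * (W 0 - c 0)) hr
    (by
      rw [← hW, dot]
      linear_combination ((W 1 - c 1) ^ 2 + (W 0 - c 0) ^ 2) * hσ)
    (by
      refine lt_of_mul_lt_mul_left (lt_of_lt_of_eq hlen ?_) hkpos.le
      simp only [X, cross]; ring)
    hz
  refine lt_of_eq_of_lt ?_ hform
  unfold cross; ring

/-- `α, β, τ, κ` are the abscissae of the corners and of the tangency points on the two slanted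
sides, `s, t` the weights of the middle tangency point between the corners. -/
lemma corner_signs {α β τ κ s t : ℝ} (hα : 0 < α * τ) (hβ : 0 < β * κ) (hs : 0 ≤ s) (ht : 0 ≤ t)
    (hst : s + t = 1) (h0 : s * α + t * β = 0) (ho : 0 ≤ κ * τ * (α - β)) : α < 0 ∧ 0 < β := by
  have hne : 0 ≤ α * β → False := fun h => by
    have hα0 : α ≠ 0 := by rintro rfl; simp at hα
    have hβ0 : β ≠ 0 := by rintro rfl; simp at hβ
    have h1 : s * α ^ 2 + t * (α * β) = 0 := by linear_combination α * h0
    have h2 : s * (α * β) + t * β ^ 2 = 0 := by linear_combination β * h0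
    have hs0 : s * α ^ 2 = 0 := by
      linarith [mul_nonneg ht h, mul_nonneg hs (sq_nonneg α)]
    have ht0 : t * β ^ 2 = 0 := by
      linarith [mul_nonneg hs h, mul_nonneg ht (sq_nonneg β)]
    simp [hα0] at hs0
    simp [hβ0] at ht0
    linarith
  rcases lt_trichotomy α 0 with h | rfl | h
  · exact ⟨h, by by_contra! hb; exact hne (mul_nonneg_of_nonpos_of_nonpos h.le hb)⟩
  · simp at hα
  · exfalso
    have hb : β < 0 := by by_contra! hb; exact hne (mul_nonneg h.le hb)
    have hτ : 0 < τ := pos_of_mul_pos_right hα h.le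
    have hκ : κ < 0 := by by_contra! hk; nlinarith
    nlinarith [mul_pos (mul_pos hτ (neg_pos.2 hκ)) (by linarith : 0 < α - β)]

/-- Consequences of tangency for points on the line `uv` and to its left. -/
lemma dot_bounds_of_tangent {u v c T w : E2} {r : ℝ} (hr : 0 < r)
    (hle : r * dist u v ≤ orient u v c) (hT : T ∈ Metric.closedBall c r)
    (hTs : T ∈ segment ℝ u v) (hw : 0 < orient u v w) :
    (∀ z, orient u v z = 0 → dot c T z = r ^ 2) ∧
    (∀ z, 0 ≤ orient u v z → dot c T z ≤ r ^ 2) ∧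
    (∀ z, 0 < orient u v z → dot c T z < r ^ 2) := by
  have h := tangent_identity hr.le hle hT (orient_eq_zero_of_mem_segment hTs)
  have hd : 0 < dist u v := by
    refine dist_pos.2 ?_
    rintro rfl
    simp [orient] at hw
  refine ⟨fun z hz => ?_, fun z hz => ?_, fun z hz => ?_⟩
  · have := h z
    rw [hz, mul_zero] at this
    linarith [(mul_eq_zero.1 this).resolve_left hd.ne']
  · have := nonneg_of_mul_nonneg_right ((h z).symm ▸ mul_nonneg hr.le hz) hd
    linarith
  · have := pos_of_mul_pos_right ((h z).symm ▸ mul_pos hr hz) hd.le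
    linarith

lemma sideDisk_comm (u v : E2) : sideDisk u v = sideDisk v u := by
  rw [sideDisk, sideDisk, midpoint_comm, dist_comm]

lemma orient_swap (u v w : E2) : orient v u w = -orient u v w := by
  unfold orient; ring

/-- Independence lemma: if a closed disk `Q` contained in the convex polygon `P` touches
the three sides `s_i, s_j, s_k` (`i < j < k`), the supporting lines of `s_i` and `s_j`
meet at `A`, those of `s_j` and `s_k` meet at `B`, and `s_j ⊆ AB`, then every side disk
`D_a` with `i < a < j` is disjoint from every side disk `D_b` with `j < b < k`. -/
theorem indep_lemma (n : ℕ) (hn : 3 ≤ n) (p : Fin n → E2) (hconv : IsConvexPolygon p)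
    (i j k : Fin n) (hij : i < j) (hjk : j < k)
    (c : E2) (r : ℝ) (hr : 0 ≤ r)
    (hQsub : Metric.closedBall c r ⊆ convexHull ℝ (Set.range p))
    (hQi : (Metric.closedBall c r ∩ segment ℝ (p i) (p (nxt i))).Nonempty)
    (hQj : (Metric.closedBall c r ∩ segment ℝ (p j) (p (nxt j))).Nonempty)
    (hQk : (Metric.closedBall c r ∩ segment ℝ (p k) (p (nxt k))).Nonempty)
    (A B : E2)
    (hA : A ∈ affineSpan ℝ ({p i, p (nxt i)} : Set E2) ∧
          A ∈ affineSpan ℝ ({p j, p (nxt j)} : Set E2))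
    (hB : B ∈ affineSpan ℝ ({p j, p (nxt j)} : Set E2) ∧
          B ∈ affineSpan ℝ ({p k, p (nxt k)} : Set E2))
    (hsj : segment ℝ (p j) (p (nxt j)) ⊆ segment ℝ A B) :
    ∀ a b : Fin n, i < a → a < j → j < b → b < k →
      polyDisk p a ∩ polyDisk p b = ∅ := by
  intro a b hia haj hjb hbk
  obtain ⟨Ti, hTi, hTi'⟩ := hQi
  obtain ⟨W, hW, hW'⟩ := hQj
  obtain ⟨Tk, hTk, hTk'⟩ := hQk
  have hi1 := nxt_val_of_lt_fin hia
  have hj1 := nxt_val_of_lt_fin hjb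
  have ha1 := nxt_val_of_lt_fin haj
  have hb1 := nxt_val_of_lt_fin hbk
  have hedge : ∀ m, r * dist (p m) (p (nxt m)) ≤ orient (p m) (p (nxt m)) c := fun m =>
    mul_dist_le_orient hr fun z hz => hconv.orient_side_nonneg_of_mem_convexHull m (hQsub hz)
  have hjpos : ∀ l : Fin n, (l : ℕ) < j ∨ (j : ℕ) + 1 < l →
      0 < orient (p j) (p (nxt j)) (p l) := fun l hl =>
    hconv.orient_side_pos (by rintro rfl; omega) (by rintro rfl; omega)
  have hjTi : 0 < orient (p j) (p (nxt j)) Ti :=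
    orient_pos_of_mem_segment hTi' (hjpos _ (by omega)) (hjpos _ (by omega))
  have hjTk : 0 < orient (p j) (p (nxt j)) Tk := by
    refine orient_pos_of_mem_segment hTk' (hjpos _ (by omega)) (hjpos _ ?_)
    rcases nxt_val_cases k with h | h <;> omega
  have hr0 : 0 < r := by
    refine hr.lt_of_ne ?_
    rintro rfl
    rw [Metric.closedBall_zero, Set.mem_singleton_iff] at hTi hW
    rw [hTi, ← hW, orient_eq_zero_of_mem_segment hW'] at hjTi
    exact hjTi.false
  obtain ⟨eqi, lei, -⟩ := dot_bounds_of_tangent hr0 (hedge i) hTi hTi'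
    (hconv.orient_side_pos (l := j) (by rintro rfl; omega) (by
      rintro h
      have := congrArg Fin.val h
      omega))
  obtain ⟨eqj, lej, ltj⟩ := dot_bounds_of_tangent hr0 (hedge j) hW hW' hjTi
  obtain ⟨eqk, lek, -⟩ := dot_bounds_of_tangent hr0 (hedge k) hTk hTk'
    (hconv.orient_side_pos (l := j) (by rintro rfl; omega) (by
      rintro h
      have := congrArg Fin.val h
      rcases nxt_val_cases k with h | h <;> omega))
  -- orientations of vertices relative to the tangency chords
  have hchain_i : ∀ m : Fin n, i < m → m ≤ j → 0 ≤ orient W Ti (p m) := fun m him hmj => by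
    have h1 : nxt i ≤ m := Fin.le_def.2 (by omega)
    have h2 : m ≤ nxt j := Fin.le_def.2 (by omega)
    rw [← orient_cyclic]
    apply orient_nonneg_of_mem_segment hTi' <;> rw [← orient_cyclic] <;>
      apply orient_nonneg_of_mem_segment hW' <;> apply hconv.orient_nonneg <;>
      first | assumption | exact him.le
  have hchain_k : ∀ m : Fin n, j < m → m ≤ k → 0 ≤ -orient W Tk (p m) := fun m hjm hmk => by
    have h1 : nxt j ≤ m := Fin.le_def.2 (by omega)
    rw [← orient_swap, orient_cyclic]
    apply orient_nonneg_of_mem_segment hTk' <;> rw [orient_cyclic] <;>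
      apply orient_nonneg_of_mem_segment hW' <;> rw [← orient_cyclic] <;>
      first | apply hconv.orient_nxt_nonneg | apply hconv.orient_nonneg
    all_goals first | assumption | exact hjm.le
  have hTTT : 0 ≤ orient W Tk Ti := by
    have h1 : nxt i ≤ j := Fin.le_def.2 (by omega)
    have h2 : nxt j ≤ k := Fin.le_def.2 (by omega)
    have h3 : i ≤ nxt j := Fin.le_def.2 (by omega)
    have h4 : nxt i ≤ nxt j := Fin.le_def.2 (by omega)
    rw [← orient_cyclic]
    apply orient_nonneg_of_mem_segment hTk' <;> rw [← orient_cyclic] <;>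
      apply orient_nonneg_of_mem_segment hW' <;> rw [← orient_cyclic] <;>
      apply orient_nonneg_of_mem_segment hTi' <;> rw [← orient_cyclic] <;>
      first | apply hconv.orient_nxt_nonneg | apply hconv.orient_nonneg
    all_goals first | assumption | exact hij.le | exact hjk.le
  obtain ⟨s, t, hs, ht, hst, hWAB⟩ := exists_of_mem_segment (hsj hW')
  have hWW := eqj W (orient_eq_zero_of_mem_segment hW')
  have hjA := eqj A (orient_eq_zero_of_mem_line hA.2)
  have hjB := eqj B (orient_eq_zero_of_mem_line hB.1)
  have hiA := eqi A (orient_eq_zero_of_mem_line hA.1)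
  have hkB := eqk B (orient_eq_zero_of_mem_line hB.2)
  have hWTi := ltj Ti hjTi
  have hWTk := ltj Tk hjTk
  have hprod : ∀ T C, dot c W C = r ^ 2 → dot c T C = r ^ 2 →
      cross c W C * cross c W T = r ^ 2 * (r ^ 2 - dot c W T) := fun T C h1 h2 => by
    have e : cross c W C * cross c W T + dot c W C * dot c W T = dot c W W * dot c T C := by
      unfold cross dot; ring
    rw [hWW, h1, h2] at e
    linarith
  have hα := hprod Ti A hjA hiA
  have hβ := hprod Tk B hjB hkB
  have hr2 : 0 < r ^ 2 := by positivity
  obtain ⟨hA0, hB0⟩ := corner_signs (α := cross c W A) (β := cross c W B)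
    (τ := cross c W Ti) (κ := cross c W Tk)
    (hα ▸ mul_pos hr2 (sub_pos.2 hWTi)) (hβ ▸ mul_pos hr2 (sub_pos.2 hWTk)) hs ht hst
    (by
      obtain rfl : s = 1 - t := by linarith
      have h0 := hWAB 0
      have h1 := hWAB 1
      unfold cross
      linear_combination (W 1 - c 1) * h0 - (W 0 - c 0) * h1)
    (by
      have e : cross c W Tk * (dot c W W - dot c W Ti) -
          (dot c W W - dot c W Tk) * cross c W Ti = dot c W W * orient W Tk Ti := by
        unfold cross dot orient; ring
      rw [hWW] at e
      have : cross c W Tk * cross c W Ti * (cross c W A - cross c W B) =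
          r ^ 2 * (r ^ 2 * orient W Tk Ti) := by
        linear_combination cross c W Tk * hα - cross c W Ti * hβ + r ^ 2 * e
      rw [this]; positivity)
  rw [Set.eq_empty_iff_forall_notMem]
  rintro z ⟨hza, hzb⟩
  have hleft := cross_neg_of_mem_sideDisk (σ := 1) (u := p a) (v := p (nxt a)) hr0 (by norm_num)
    hWW (eqi Ti (orient_eq_zero_of_mem_segment hTi')) hWTi hjA hiA (by simpa using hA0)
    (ltj _ (hjpos a (by omega))) (lei _ (hconv.orient_side_nonneg _ _))
    (by rw [one_mul]; exact hchain_i a hia haj.le)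
    (lej _ (hconv.orient_side_nonneg _ _)) (lei _ (hconv.orient_side_nonneg _ _))
    (by rw [one_mul]; exact hchain_i _ (Fin.lt_def.2 (by omega)) (Fin.le_def.2 (by omega)))
    (by rw [one_mul]; exact hedge a) hza
  have hright := cross_neg_of_mem_sideDisk (σ := -1) (u := p (nxt b)) (v := p b) hr0
    (by norm_num) hWW (eqk Tk (orient_eq_zero_of_mem_segment hTk')) hWTk hjB hkB (by simpa using hB0)
    (ltj _ (hjpos _ (by omega))) (lek _ (hconv.orient_side_nonneg _ _))
    (by
      rw [neg_one_mul]
      exact hchain_k _ (Fin.lt_def.2 (by omega)) (Fin.le_def.2 (by omega)))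
    (lej _ (hconv.orient_side_nonneg _ _)) (lek _ (hconv.orient_side_nonneg _ _))
    (by rw [neg_one_mul]; exact hchain_k b hjb hbk.le)
    (by rw [orient_swap, neg_one_mul, neg_neg, dist_comm]; exact hedge b)
    (by rw [sideDisk_comm]; exact hzb)
  linarith
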